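/- Let n ≥ 1, let Γ be a finite subgroup of the unitary group U_n(ℂ), let {g_1, …, g_r} be a set of primitive pseudoreflections of Γ, and let Q be the set of g ∈ Γ whose eigenvalue 1 has multiplicity exactly n−2, i.e., whose characteristic polynomial factors as (X−1)^{n−2} q_g(X) with q_g a quadratic polynomial satisfying q_g(1) ≠ 0. Let G be a function analytic on a neighborhood N of 1 in ℂ with G(x) = (1 − x)^{2n}·M_Γ(x) for all x ∈ N with |x| < 1. Then G⁗(1)/24 = (1/|Γ|) ( Σ_{i=1}^r ( −ord(g_i)⁴ + 50·ord(g_i)² − 49 )/720 + Σ_{g∈Q} det(g)/q_g(1)² ) and −G^{(5)}(1)/120 = (1/|Γ|) ( Σ_{i=1}^r ( −2·ord(g_i)⁴ + 40·ord(g_i)² − 38 )/720 + Σ_{g∈Q} 2·det(g)/q_g(1)² ). (Equivalently: the Laurent coefficients γ_4 and γ_5 of the Hilbert series of the real invariants of Γ are given by these formulas; for g ∈ Q with non-unit eigenvalues λ_g, μ_g one has det(g)/q_g(1)² = λ_g μ_g/((1−λ_g)²(1−μ_g)²).) -/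

import Mathlib

open Filter Topology Finset Polynomial

lemma shift_sum (m : ℕ) (l : ℂ) (hl : l ^ m = 1) (c : ℕ → ℂ) :
    l * ∑ j ∈ range m, c (j + 1) * l ^ j = (∑ j ∈ range m, c j * l ^ j) + c m - c 0 := by
  have h1 := Finset.sum_range_succ (fun j => c j * l ^ j) m
  have h2 := Finset.sum_range_succ' (fun j => c j * l ^ j) m
  rw [h1] at h2
  simp only [hl, pow_zero, mul_one] at h2
  rw [h2, Finset.mul_sum, add_sub_cancel_right]
  exact Finset.sum_congr rfl fun j _ => by ring

lemma shift_sum2 (m : ℕ) (l : ℂ) (hl : l ^ m = 1) (c : ℕ → ℂ) (h0 : c m = c 0) :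
    l ^ 2 * ∑ j ∈ range m, (c (j + 2) - 2 * c (j + 1) + c j) * l ^ j
      = (1 - l) ^ 2 * (∑ j ∈ range m, c j * l ^ j) + l * (c (m + 1) - c 1) := by
  have h1 := shift_sum m l hl c
  have h2 := shift_sum m l hl (fun j => c (j + 1))
  simp only [zero_add, add_assoc, one_add_one_eq_two] at h2
  have h3 : ∑ j ∈ range m, (c (j + 2) - 2 * c (j + 1) + c j) * l ^ j
      = ∑ j ∈ range m, c (j + 2) * l ^ j - 2 * ∑ j ∈ range m, c (j + 1) * l ^ j
        + ∑ j ∈ range m, c j * l ^ j := by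
    rw [Finset.mul_sum, ← Finset.sum_sub_distrib, ← Finset.sum_add_distrib]
    exact Finset.sum_congr rfl fun j _ => by ring
  rw [h3]
  linear_combination l * h2 + (1 - 2 * l) * h1 + (1 - 2 * l) * h0

lemma geom_zero (m : ℕ) (l : ℂ) (hl : l ^ m = 1) (h1 : l ≠ 1) : ∑ j ∈ range m, l ^ j = 0 := by
  rw [geom_sum_eq h1, hl]; simp

noncomputable def cc (m : ℕ) (j : ℕ) : ℂ := (j : ℂ) ^ 2 / (2 * m) - j / 2
noncomputable def dd (m : ℕ) (j : ℕ) : ℂ :=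
  -(j : ℂ) ^ 4 / (24 * m) + j ^ 3 / 12 + (2 - (m : ℂ) ^ 2) * j ^ 2 / (24 * m) - j / 12

lemma cc_sum (m : ℕ) (hm : 0 < m) (l : ℂ) (hl : l ^ m = 1) (h1 : l ≠ 1) :
    ∑ j ∈ range m, cc m j * l ^ j = -l / (1 - l) ^ 2 := by
  have hm' : (m : ℂ) ≠ 0 := by exact_mod_cast hm.ne'
  have h1' : 1 - l ≠ 0 := sub_ne_zero.2 h1.symm
  have h := shift_sum2 m l hl (cc m) (by simp [cc]; field_simp; ring)
  have e : ∀ j, cc m (j + 2) - 2 * cc m (j + 1) + cc m j = 1 / m := by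
    intro j; simp only [cc]; push_cast; field_simp; ring
  simp only [e, ← Finset.mul_sum, geom_zero m l hl h1] at h
  have e2 : cc m (m + 1) - cc m 1 = 1 := by simp only [cc]; push_cast; field_simp; ring
  rw [e2] at h
  rw [eq_div_iff (pow_ne_zero 2 h1')]
  linear_combination -h

lemma dd_sum (m : ℕ) (hm : 0 < m) (l : ℂ) (hl : l ^ m = 1) (h1 : l ≠ 1) :
    ∑ j ∈ range m, dd m j * l ^ j = (-l / (1 - l) ^ 2) ^ 2 := by
  have hm' : (m : ℂ) ≠ 0 := by exact_mod_cast hm.ne'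
  have h1' : 1 - l ≠ 0 := sub_ne_zero.2 h1.symm
  have h := shift_sum2 m l hl (dd m) (by simp [dd]; field_simp; ring)
  obtain ⟨k, e⟩ : ∃ k : ℂ, ∀ j, dd m (j + 2) - 2 * dd m (j + 1) + dd m j = -cc m (j+1) + k := by
    refine ⟨-2 / (24 * m) + 2 * (2 - (m : ℂ) ^ 2) / (24 * m), ?_⟩
    intro j; simp only [cc, dd]; push_cast; field_simp; ring
  have e3 : ∑ j ∈ range m, (-cc m (j+1) + k) * l ^ j = - ∑ j ∈ range m, cc m (j+1) * l ^ j := by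
    have : ∑ j ∈ range m, (-cc m (j+1) + k) * l ^ j
      = - ∑ j ∈ range m, cc m (j+1) * l ^ j + k * ∑ j ∈ range m, l ^ j := by
      rw [Finset.mul_sum, ← Finset.sum_neg_distrib, ← Finset.sum_add_distrib]
      exact Finset.sum_congr rfl fun j _ => by ring
    rw [this, geom_zero m l hl h1]; ring
  simp only [e, e3] at h
  have e2 : dd m (m + 1) - dd m 1 = 0 := by simp only [dd]; push_cast; field_simp; ring
  rw [e2] at h
  have h5 := shift_sum m l hl (cc m)
  have e6 : cc m m = cc m 0 := by simp [cc]; field_simp; ring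
  rw [cc_sum m hm l hl h1, e6] at h5
  have : (∑ j ∈ range m, dd m j * l ^ j) * (1 - l) ^ 2 = (-l / (1 - l) ^ 2) ^ 2 * (1 - l) ^ 2 := by
    have h7 : (-l / (1 - l) ^ 2) ^ 2 * (1 - l) ^ 2 = (-l / (1 - l) ^ 2) * (-l) := by
      field_simp
    rw [h7]
    linear_combination -h - l * h5
  exact mul_right_cancel₀ (pow_ne_zero 2 h1') this

lemma sum_roots (m : ℕ) (hm : 0 < m) (z : ℂ) (hz : IsPrimitiveRoot z m) (c : ℕ → ℂ) (c0 : c 0 = 0) :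
    ∑ k ∈ Ico 1 m, ∑ j ∈ range m, c j * (z ^ k) ^ j = - ∑ j ∈ range m, c j := by
  rw [Finset.sum_comm, ← Finset.sum_neg_distrib]
  refine Finset.sum_congr rfl fun j hj => ?_
  rw [← Finset.mul_sum]
  rcases Nat.eq_zero_or_pos j with rfl | h
  · simp [c0]
  have h2 := geom_zero m (z ^ j) (by rw [← pow_mul, mul_comm, pow_mul, hz.pow_eq_one, one_pow])
    (hz.pow_ne_one_of_pos_of_lt h.ne' (Finset.mem_range.1 hj))
  rw [Finset.range_eq_Ico, Finset.sum_eq_sum_Ico_succ_bot hm] at h2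
  have : ∑ k ∈ Ico 1 m, (z ^ k) ^ j = -1 := by
    rw [← add_eq_zero_iff_eq_neg, ← h2, add_comm, pow_zero, zero_add]
    congr 1
    exact Finset.sum_congr rfl fun k _ => by rw [← pow_mul, ← pow_mul, mul_comm]
  rw [this]; ring

lemma cc_total (m : ℕ) (hm : 0 < m) : ∑ j ∈ range m, cc m j = -((m : ℂ) ^ 2 - 1) / 12 := by
  have hm' : (m : ℂ) ≠ 0 := by exact_mod_cast hm.ne'
  have : ∀ (a : ℂ) (M : ℕ), a ≠ 0 → ∑ j ∈ range M, ((j : ℂ) ^ 2 / (2 * a) - j / 2)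
      = (M - 1) * M * (2 * M - 1) / (12 * a) - M * (M - 1) / 4 := by
    intro a M ha
    induction M with
    | zero => simp
    | succ M ih => rw [Finset.sum_range_succ, ih]; push_cast; field_simp; ring
  simp only [cc]
  rw [this m m hm']; field_simp; ring

lemma dd_total (m : ℕ) (hm : 0 < m) :
    ∑ j ∈ range m, dd m j = -((m : ℂ) ^ 2 - 1) * (m ^ 2 + 11) / 720 := by
  have hm' : (m : ℂ) ≠ 0 := by exact_mod_cast hm.ne'
  have : ∀ (a : ℂ) (M : ℕ), a ≠ 0 → ∑ j ∈ range M,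
      (-(j : ℂ) ^ 4 / (24 * a) + j ^ 3 / 12 + (2 - a ^ 2) * j ^ 2 / (24 * a) - j / 12)
      = -((M - 1) * M * (2 * M - 1) * (3 * M ^ 2 - 3 * M - 1)) / (720 * a)
        + M ^ 2 * (M - 1) ^ 2 / 48
        + (2 - a ^ 2) * ((M - 1) * M * (2 * M - 1)) / (144 * a) - M * (M - 1) / 24 := by
    intro a M ha
    induction M with
    | zero => simp
    | succ M ih => rw [Finset.sum_range_succ, ih]; push_cast; field_simp; ring
  simp only [dd]
  rw [this m m hm']; field_simp; ring

noncomputable def uu (l : ℂ) : ℂ := -l / (1 - l) ^ 2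

lemma uu_sum (m : ℕ) (hm : 0 < m) (z : ℂ) (hz : IsPrimitiveRoot z m) :
    ∑ k ∈ Ico 1 m, uu (z ^ k) = ((m : ℂ) ^ 2 - 1) / 12 := by
  have := sum_roots m hm z hz (cc m) (by simp [cc])
  rw [cc_total m hm] at this
  rw [show ((m : ℂ) ^ 2 - 1) / 12 = - (-((m : ℂ) ^ 2 - 1) / 12) by ring, ← this]
  refine Finset.sum_congr rfl fun k hk => ?_
  rw [Finset.mem_Ico] at hk
  rw [cc_sum m hm, uu]
  · rw [← pow_mul, mul_comm, pow_mul, hz.pow_eq_one, one_pow]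
  · exact hz.pow_ne_one_of_pos_of_lt (by omega) hk.2

lemma uu_sum_sq (m : ℕ) (hm : 0 < m) (z : ℂ) (hz : IsPrimitiveRoot z m) :
    ∑ k ∈ Ico 1 m, uu (z ^ k) ^ 2 = ((m : ℂ) ^ 2 - 1) * (m ^ 2 + 11) / 720 := by
  have := sum_roots m hm z hz (dd m) (by simp [dd])
  rw [dd_total m hm] at this
  rw [show ((m : ℂ) ^ 2 - 1) * (m ^ 2 + 11) / 720
    = - (-((m : ℂ) ^ 2 - 1) * (m ^ 2 + 11) / 720) by ring, ← this]
  refine Finset.sum_congr rfl fun k hk => ?_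
  rw [Finset.mem_Ico] at hk
  rw [dd_sum m hm, uu]
  · rw [← pow_mul, mul_comm, pow_mul, hz.pow_eq_one, one_pow]
  · exact hz.pow_ne_one_of_pos_of_lt (by omega) hk.2

def PR {n : ℕ} (A : Matrix (Fin n) (Fin n) ℂ) (lam : ℂ) : Prop :=
  lam ≠ 1 ∧ A.charpoly = (X - 1) ^ (n - 1) * (X - C lam)

section
variable {n : ℕ} {A : Matrix (Fin n) (Fin n) ℂ} {lam : ℂ} {m : ℕ}

lemma PR.quad (h : PR A lam) (hm : 0 < m) (hA : A ^ m = 1) :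
    (A - 1) * (A - lam • 1) = 0 := by
  set S : ℂ[X] := ∑ j ∈ range m, X ^ j with hS
  have hco : IsCoprime ((X - C (1:ℂ)) ^ (n - 1)) S := by
    apply IsCoprime.pow_left
    rw [(Polynomial.irreducible_X_sub_C (1:ℂ)).coprime_iff_not_dvd, Polynomial.dvd_iff_isRoot]
    simp [hS, Polynomial.eval_finsetSum, hm.ne']
  obtain ⟨a, b, hab⟩ := hco
  have h1 : aeval A ((X - C (1:ℂ)) ^ (n - 1) * (X - C lam)) = 0 := by
    have := Matrix.aeval_self_charpoly A
    rw [h.2] at this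
    simpa using this
  have h2 : aeval A (S * (X - C 1)) = 0 := by
    rw [hS, map_one, geom_sum_mul]
    simp [hA]
  have h3 : (X - C (1:ℂ)) * (X - C lam) = a * (X - C 1) * ((X - C (1:ℂ)) ^ (n - 1) * (X - C lam))
      + b * (X - C lam) * (S * (X - C 1)) := by
    linear_combination -((X - C (1:ℂ)) * (X - C lam)) * hab
  have h4 := congrArg (aeval A) h3
  rw [map_add, map_mul _ _ ((X - C (1:ℂ)) ^ (n - 1) * (X - C lam)), h1,
    map_mul _ _ (S * (X - C 1)), h2] at h4
  simpa [Algebra.algebraMap_eq_smul_one] using h4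

lemma PR.pow_eq (h : PR A lam) (hm : 0 < m) (hA : A ^ m = 1) (k : ℕ) :
    (lam - 1) • (A ^ k - 1) = (lam ^ k - 1) • (A - 1) := by
  have hq := h.quad hm hA
  have hq' : A * (A - 1) = lam • (A - 1) := by
    have e : (A - 1) * (A - lam • 1) = A * (A - 1) - lam • (A - 1) := by
      simp [mul_sub, sub_mul, smul_sub]
    rw [e] at hq
    exact sub_eq_zero.1 hq
  induction k with
  | zero => simp
  | succ k ih =>
    have e : A ^ (k + 1) - 1 = A * (A ^ k - 1) + (A - 1) := by
      rw [pow_succ', mul_sub, mul_one]; abel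
    rw [e, smul_add, ← mul_smul_comm, ih, mul_smul_comm, hq', smul_smul, ← add_smul]
    congr 1; ring

lemma PR.ne_one (h : PR A lam) : A ≠ 1 := by
  rintro rfl
  have h2 := congrArg (eval lam) h.2
  have h1 := h.1
  rw [Matrix.eval_charpoly] at h2
  have e : (Matrix.scalar (Fin n)) lam - 1 = (lam - 1) • 1 := by
    simp [sub_smul, Matrix.smul_one_eq_diagonal]
  rw [e, Matrix.det_smul] at h2
  simp at h2
  exact sub_ne_zero.2 h1 h2.1

lemma PR.pow_eq_one_iff (h : PR A lam) (hm : 0 < m) (hA : A ^ m = 1) (k : ℕ) :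
    A ^ k = 1 ↔ lam ^ k = 1 := by
  have := h.pow_eq hm hA k
  have h1 : lam - 1 ≠ 0 := sub_ne_zero.2 h.1
  have h2 : A - 1 ≠ 0 := sub_ne_zero.2 h.ne_one
  constructor
  · intro hk
    rw [hk, sub_self, smul_zero, eq_comm, smul_eq_zero] at this
    exact sub_eq_zero.1 (this.resolve_right h2)
  · intro hk
    rw [hk, sub_self, zero_smul, smul_eq_zero] at this
    exact sub_eq_zero.1 (this.resolve_left h1)

lemma PR.pow (hn : 1 ≤ n) (h : PR A lam) (hm : 0 < m) (hA : A ^ m = 1) (k : ℕ) (hk : lam ^ k ≠ 1) :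
    PR (A ^ k) (lam ^ k) := by
  refine ⟨hk, ?_⟩
  have h1 : lam - 1 ≠ 0 := sub_ne_zero.2 h.1
  have h2 : lam ^ k - 1 ≠ 0 := sub_ne_zero.2 hk
  apply Polynomial.funext
  intro z
  set s := (lam ^ k - 1) / (lam - 1) with hs
  have hs0 : s ≠ 0 := div_ne_zero h2 h1
  have e1 : A ^ k - 1 = s • (A - 1) := by
    have := h.pow_eq hm hA k
    rw [hs, div_eq_inv_mul, mul_smul, ← this, smul_smul, inv_mul_cancel₀ h1, one_smul]
  have e2 : (Matrix.scalar (Fin n)) z - A ^ k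
      = s • ((Matrix.scalar (Fin n)) (1 + (z - 1) / s) - A) := by
    have : A ^ k = 1 + s • (A - 1) := by rw [← e1]; abel
    rw [this]
    simp only [Matrix.scalar_apply, ← Matrix.smul_one_eq_diagonal, smul_sub, smul_smul, mul_add,
      mul_div_cancel₀ _ hs0]
    simp only [add_smul, sub_smul, mul_one]
    simp
    abel
  rw [Matrix.eval_charpoly, e2, Matrix.det_smul, ← Matrix.eval_charpoly, h.2]
  obtain ⟨n, rfl⟩ : ∃ n', n = n' + 1 := ⟨n - 1, by omega⟩
  have e3 : s * (1 + (z - 1) / s - lam) = z - lam ^ k := by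
    have : s * (lam - 1) = lam ^ k - 1 := by rw [hs]; field_simp
    field_simp
    linear_combination -this
  have e4 : s ^ n * ((z - 1) / s) ^ n = (z - 1) ^ n := by
    rw [← mul_pow, mul_div_cancel₀ _ hs0]
  simp
  rw [← e3, ← e4]
  ring

lemma PR.det_eq (hn : 1 ≤ n) (h : PR A lam) : A.det = lam := by
  rw [Matrix.det_eq_sign_charpoly_coeff, h.2, coeff_zero_eq_eval_zero]
  obtain ⟨n, rfl⟩ : ∃ n', n = n' + 1 := ⟨n - 1, by omega⟩
  simp [pow_succ]
  rw [← mul_assoc, ← mul_pow]; simp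

end

def EX (f : ℂ → ℂ) (a4 a5 : ℂ) : Prop :=
  ∃ a : ℕ → ℂ, a 4 = a4 ∧ a 5 = a5 ∧ ∃ R : ℂ → ℂ, AnalyticAt ℂ R 1 ∧
    ∀ᶠ x in 𝓝[≠] (1 : ℂ), f x = ∑ j ∈ range 6, a j * (1 - x) ^ j + (1 - x) ^ 6 * R x

lemma EX.congr {f g : ℂ → ℂ} {a4 a5 : ℂ} (h : EX f a4 a5) (hfg : ∀ᶠ x in 𝓝[≠] (1 : ℂ), g x = f x) :
    EX g a4 a5 := by
  obtain ⟨a, h4, h5, R, hR, he⟩ := h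
  refine ⟨a, h4, h5, R, hR, ?_⟩
  filter_upwards [he, hfg] with x h1 h2
  rw [h2, h1]

lemma EX.sum {ι : Type*} (s : Finset ι) (f : ι → ℂ → ℂ) (a4 a5 : ι → ℂ)
    (h : ∀ i ∈ s, EX (f i) (a4 i) (a5 i)) :
    EX (fun x => ∑ i ∈ s, f i x) (∑ i ∈ s, a4 i) (∑ i ∈ s, a5 i) := by
  classical
  induction s using Finset.induction_on with
  | empty => exact ⟨fun _ => 0, by simp, by simp, fun _ => 0, analyticAt_const, by simp⟩
  | insert i s hi ih =>
    obtain ⟨a, h4, h5, R, hR, he⟩ := h i (by simp)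
    obtain ⟨b, h4', h5', R', hR', he'⟩ := ih (fun j hj => h j (by simp [hj]))
    refine ⟨fun j => a j + b j, ?_, ?_, fun x => R x + R' x, hR.add hR', ?_⟩
    · simp only [Finset.sum_insert hi, h4, h4']
    · simp only [Finset.sum_insert hi, h5, h5']
    · filter_upwards [he, he'] with x h1 h2
      rw [Finset.sum_insert hi, h1, h2]
      simp only [add_mul, Finset.sum_add_distrib]
      ring

lemma EX.const_mul {f : ℂ → ℂ} {a4 a5 : ℂ} (c : ℂ) (h : EX f a4 a5) :
    EX (fun x => c * f x) (c * a4) (c * a5) := by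
  obtain ⟨a, h4, h5, R, hR, he⟩ := h
  refine ⟨fun j => c * a j, by simp only [h4], by simp only [h5], fun x => c * R x, analyticAt_const.mul hR, ?_⟩
  filter_upwards [he] with x h1
  rw [h1, mul_add, Finset.mul_sum]
  simp only [mul_assoc]
  ring

lemma iter_pow (i j : ℕ) : iteratedDeriv i (fun x : ℂ => (1 - x) ^ j) 1
    = (-1) ^ i * if i = j then (j.factorial : ℂ) else 0 := by
  have := iteratedDeriv_comp_const_sub i (fun x : ℂ => x ^ j) 1
  rw [this]
  simp only [sub_self, iteratedDeriv_fun_pow_zero]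
  simp

lemma iter_poly (i : ℕ) (hi : i < 6) (a : ℕ → ℂ) (R : ℂ → ℂ) (hR : AnalyticAt ℂ R 1) :
    iteratedDeriv i (fun x => ∑ j ∈ range 6, a j * (1 - x) ^ j + (1 - x) ^ 6 * R x) 1
      = (-1) ^ i * i.factorial * a i := by
  have hp : ∀ j : ℕ, AnalyticAt ℂ (fun x : ℂ => (1 - x) ^ j) 1 := fun j => by fun_prop
  have h1 : iteratedDeriv i (fun x => (1 - x) ^ 6 * R x) 1 = 0 := by
    have := iteratedDeriv_mul (n := i) (hp 6).contDiffAt hR.contDiffAt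
    refine Eq.trans this (Finset.sum_eq_zero fun k hk => ?_)
    rw [Finset.mem_range] at hk
    rw [iter_pow, if_neg (by omega)]; simp
  have h2 : iteratedDeriv i (fun x => ∑ j ∈ range 6, a j * (1 - x) ^ j) 1
      = (-1) ^ i * i.factorial * a i := by
    have hs := iteratedDeriv_fun_sum (n := i) (x := (1 : ℂ)) (I := range 6)
      (f := fun (j : ℕ) (x : ℂ) => a j * (1 - x) ^ j)
      (fun j _ => (analyticAt_const.mul (hp j)).contDiffAt)
    rw [hs, Finset.sum_eq_single i]
    · rw [iteratedDeriv_const_mul_field, iter_pow, if_pos rfl]; ring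
    · intro j _ hj
      rw [iteratedDeriv_const_mul_field, iter_pow, if_neg hj.symm]; ring
    · intro h; simp at h; omega
  have h3 := iteratedDeriv_add (n := i) (x := (1 : ℂ))
    (f := fun x => ∑ j ∈ range 6, a j * (1 - x) ^ j)
    (g := fun x => (1 - x) ^ 6 * R x)
    (Finset.analyticAt_fun_sum _ (fun j _ => analyticAt_const.mul (hp j))).contDiffAt
    ((hp 6).mul hR).contDiffAt
  rw [h1, h2, add_zero] at h3
  exact h3

lemma EX.derivs {f G : ℂ → ℂ} {a4 a5 : ℂ} (h : EX f a4 a5) (hG : AnalyticAt ℂ G 1)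
    (hGf : ∃ᶠ x in 𝓝[≠] (1 : ℂ), G x = f x) :
    iteratedDeriv 4 G 1 = 24 * a4 ∧ iteratedDeriv 5 G 1 = -120 * a5 := by
  obtain ⟨a, h4, h5, R, hR, he⟩ := h
  have h1 : ∃ᶠ x in 𝓝[≠] (1 : ℂ),
      G x = ∑ j ∈ range 6, a j * (1 - x) ^ j + (1 - x) ^ 6 * R x := by
    refine (hGf.and_eventually he).mono ?_
    rintro x ⟨h, h'⟩
    rw [h, h']
  have h2 : G =ᶠ[𝓝 1] fun x => ∑ j ∈ range 6, a j * (1 - x) ^ j + (1 - x) ^ 6 * R x := by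
    refine (hG.frequently_eq_iff_eventually_eq ?_).1 h1
    have hp : ∀ j : ℕ, AnalyticAt ℂ (fun x : ℂ => (1 - x) ^ j) 1 := fun j => by fun_prop
    exact (Finset.analyticAt_fun_sum _ (fun j _ => analyticAt_const.mul (hp j))).add ((hp 6).mul hR)
  rw [h2.iteratedDeriv_eq, h2.iteratedDeriv_eq, iter_poly 4 (by norm_num) a R hR,
    iter_poly 5 (by norm_num) a R hR, h4, h5]
  norm_num [Nat.factorial]

lemma freq_disc (N : Set ℂ) (hN : N ∈ 𝓝 (1 : ℂ)) (P : ℂ → Prop)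
    (h : ∀ x ∈ N, ‖x‖ < 1 → P x) : ∃ᶠ x in 𝓝[≠] (1 : ℂ), P x := by
  have ht : Tendsto (fun t : ℝ => (t : ℂ)) (𝓝[<] 1) (𝓝[≠] 1) := by
    apply tendsto_nhdsWithin_of_tendsto_nhds_of_eventually_within
    · have : ContinuousAt (fun t : ℝ => (t : ℂ)) 1 := Complex.continuous_ofReal.continuousAt
      have := this.tendsto
      simp only [Complex.ofReal_one] at this
      exact this.mono_left nhdsWithin_le_nhds
    · filter_upwards [self_mem_nhdsWithin] with t ht
      simp only [Set.mem_compl_iff, Set.mem_singleton_iff, Complex.ofReal_eq_one]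
      exact ne_of_lt ht
  apply ht.frequently
  apply Eventually.frequently
  have h1 : ∀ᶠ t : ℝ in 𝓝[<] 1, (t : ℂ) ∈ N := ht (mem_nhdsWithin_of_mem_nhds hN)
  have h2 : ∀ᶠ t : ℝ in 𝓝[<] 1, 0 < t :=
    (lt_mem_nhds (show (0:ℝ) < 1 by norm_num)).filter_mono nhdsWithin_le_nhds
  filter_upwards [h1, h2, self_mem_nhdsWithin] with t a b c
  refine h _ a ?_
  rw [Complex.norm_real, Real.norm_eq_abs, abs_of_pos b]
  exact c

lemma term_eq {n k : ℕ} (hk : k ≤ n) (A B : Matrix (Fin n) (Fin n) ℂ) (hAB : B * A = 1)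
    (q : ℂ[X]) (hA : A.charpoly = (X - 1) ^ (n - k) * q) (x : ℂ) (hx : x ≠ 1)
    (hx0 : x ≠ 0) :
    (1 - x) ^ (2 * n) * ((1 - x • A).det * (1 - x • B).det)⁻¹
      = (1 - x) ^ (2 * k) * (A.det * (-1) ^ k / (x ^ k * q.eval x⁻¹ * q.eval x)) := by
  have hd : B.det * A.det = 1 := by rw [← Matrix.det_mul, hAB, Matrix.det_one]
  have hx1 : 1 - x ≠ 0 := sub_ne_zero.2 hx.symm
  obtain ⟨d, rfl⟩ : ∃ d, n = d + k := ⟨n - k, by omega⟩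
  rw [Nat.add_sub_cancel] at hA
  have h1 : (1 - x • A).det = (1 - x) ^ d * (x ^ k * q.eval x⁻¹) := by
    have : 1 - x • A = x • (Matrix.scalar (Fin (d + k)) x⁻¹ - A) := by
      simp [smul_sub, ← Matrix.smul_one_eq_diagonal, smul_smul, hx0]
    rw [this, Matrix.det_smul, ← Matrix.eval_charpoly, hA]
    have : (1 - x) = x * (x⁻¹ - 1) := by field_simp
    rw [this, mul_pow]
    simp
    ring
  have h2 : (1 - x • B).det = B.det * ((-1) ^ k * (1 - x) ^ d * q.eval x) := by
    have : 1 - x • B = B * (-(Matrix.scalar (Fin (d + k)) x - A)) := by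
      simp [mul_sub, hAB, ← Matrix.smul_one_eq_diagonal]
    rw [this, Matrix.det_mul, Matrix.det_neg, ← Matrix.eval_charpoly, hA]
    have : (1 - x) = -1 * (x - 1) := by ring
    rw [this]
    simp only [Fintype.card_fin, eval_mul, eval_pow, eval_sub, eval_X, eval_one, mul_pow]
    ring
  have hB : B.det⁻¹ = A.det := by
    rw [inv_eq_iff_eq_inv]; exact eq_inv_of_mul_eq_one_left hd
  have hs : ((-1 : ℂ) ^ k)⁻¹ = (-1) ^ k := by rw [← inv_pow]; norm_num
  rw [h1, h2]
  have e : (1 - x) ^ (2 * (d + k)) = (1 - x) ^ (2 * k) * ((1 - x) ^ d) ^ 2 := by ring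
  rw [e, div_eq_mul_inv]
  simp only [mul_inv, hB, hs]
  have hpd := pow_ne_zero d hx1
  field_simp

lemma term_zero {n k : ℕ} (hk : k ≤ n) (A B : Matrix (Fin n) (Fin n) ℂ) (hAB : B * A = 1)
    (q : ℂ[X]) (hA : A.charpoly = (X - 1) ^ (n - k) * q)
    (a4 a5 : ℂ)
    (h : EX (fun x => (1 - x) ^ (2 * k) * (A.det * (-1) ^ k / (x ^ k * q.eval x⁻¹ * q.eval x))) a4 a5) :
    EX (fun x => (1 - x) ^ (2 * n) * ((1 - x • A).det * (1 - x • B).det)⁻¹) a4 a5 := by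
  refine h.congr ?_
  have h0 : ∀ᶠ x : ℂ in 𝓝[≠] 1, x ≠ 0 :=
    (isOpen_ne.mem_nhds (show (1 : ℂ) ≠ 0 by norm_num) : {x : ℂ | x ≠ 0} ∈ 𝓝 1)
      |> mem_nhdsWithin_of_mem_nhds
  filter_upwards [h0, self_mem_nhdsWithin] with x hx0 hx
  exact term_eq hk A B hAB q hA x hx hx0

lemma an_R (q : ℂ[X]) (k : ℕ) (c : ℂ) (hq : q.eval 1 ≠ 0) :
    AnalyticAt ℂ (fun x => (c / (x ^ k * q.eval x⁻¹ * q.eval x))) 1 := by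
  have hp : ∀ z, AnalyticAt ℂ (fun x => q.eval x) z := fun z =>
    q.differentiable.analyticAt z
  have hi : AnalyticAt ℂ (fun x : ℂ => x⁻¹) 1 := analyticAt_id.inv (by simp)
  have h2 : AnalyticAt ℂ (fun x : ℂ => q.eval x⁻¹) 1 := 
    AnalyticAt.fun_comp (g := fun x => q.eval x) (hp _) hi
  refine analyticAt_const.div (((analyticAt_id.pow k).mul h2).mul (hp 1)) ?_
  simp [hq]

lemma ex_ge3 (q : ℂ[X]) (k : ℕ) (hk : 3 ≤ k) (c : ℂ) (hq : q.eval 1 ≠ 0) :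
    EX (fun x => (1 - x) ^ (2 * k) * (c / (x ^ k * q.eval x⁻¹ * q.eval x))) 0 0 := by
  refine ⟨fun _ => 0, rfl, rfl, fun x => (1 - x) ^ (2 * k - 6) * (c / (x ^ k * q.eval x⁻¹ * q.eval x)),
    ?_, ?_⟩
  · have : AnalyticAt ℂ (fun x : ℂ => (1 - x) ^ (2 * k - 6)) 1 := by fun_prop
    exact this.mul (an_R q k c hq)
  · refine Eventually.of_forall fun x => ?_
    rw [← mul_assoc, ← pow_add, show 6 + (2 * k - 6) = 2 * k by omega]
    simp

lemma ex_0 : EX (fun x => (1 - x) ^ (2 * 0) * (1 : ℂ)) 0 0 := by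
  refine ⟨fun j => if j = 0 then 1 else 0, by simp, by simp, fun x => 0, analyticAt_const, ?_⟩
  simp

lemma ne_ev (q : ℂ[X]) (hq : q.eval 1 ≠ 0) :
    ∀ᶠ x : ℂ in 𝓝[≠] 1, x ≠ 0 ∧ q.eval x⁻¹ ≠ 0 ∧ q.eval x ≠ 0 := by
  have hi : ContinuousAt (fun x : ℂ => x⁻¹) 1 := continuousAt_inv₀ (by simp)
  have h2 : ContinuousAt (fun x : ℂ => q.eval x⁻¹) 1 :=
    ContinuousAt.comp' (g := fun x => q.eval x) q.continuous.continuousAt hi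
  have e0 : ∀ᶠ x : ℂ in 𝓝 1, x ≠ 0 := continuousAt_id.eventually_ne (by simp)
  have e1 : ∀ᶠ x : ℂ in 𝓝 1, q.eval x⁻¹ ≠ 0 := h2.eventually_ne (by simpa using hq)
  have e2 : ∀ᶠ x : ℂ in 𝓝 1, q.eval x ≠ 0 := q.continuous.continuousAt.eventually_ne hq
  exact (e0.and (e1.and e2)).filter_mono nhdsWithin_le_nhds

lemma ex_1 (l : ℂ) (hl : l ≠ 1) : EX (fun x => (1 - x) ^ (2 * 1) * (l * (-1) ^ 1 /
    (x ^ 1 * (X - C l).eval x⁻¹ * (X - C l).eval x))) (uu l - uu l ^ 2) (uu l - 2 * uu l ^ 2) := by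
  have h1 : 1 - l ≠ 0 := sub_ne_zero.2 hl.symm
  have hq : (X - C l).eval 1 ≠ 0 := by simpa using h1
  set u := uu l with hu
  refine ⟨fun j => if j = 2 then u else if j = 3 then u else if j = 4 then u - u ^ 2 else
    if j = 5 then u - 2 * u ^ 2 else 0, by simp, by simp,
    fun x => ((1 - 3 * u + u ^ 2) - (u - 2 * u ^ 2) * (1 - x)) * (l * (-1) ^ 1 /
    (x ^ 1 * (X - C l).eval x⁻¹ * (X - C l).eval x)), ?_, ?_⟩
  · have h2 := an_R (X - C l) 1 (l * (-1) ^ 1) hq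
    have h3 : AnalyticAt ℂ (fun x : ℂ => ((1 - 3 * u + u ^ 2) - (u - 2 * u ^ 2) * (1 - x))) 1 := by
      fun_prop
    exact h3.mul h2
  · filter_upwards [ne_ev (X - C l) hq] with x hx
    obtain ⟨x0, x1, x2⟩ := hx
    set W := (l * (-1) ^ 1 / (x ^ 1 * (X - C l).eval x⁻¹ * (X - C l).eval x)) with hW
    have hWD : W * (1 - (1 - x) + u * (1 - x) ^ 2) = u := by
      simp only [eval_sub, eval_X, eval_C] at x1 x2 hW
      have x1' : 1 - l * x ≠ 0 := by
        intro h; apply x1; field_simp; linear_combination h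
      have e : x ^ 1 * (x⁻¹ - l) = 1 - l * x := by field_simp
      rw [e] at hW
      rw [hW, hu, uu]
      field_simp
      ring
    simp [Finset.sum_range_succ]
    linear_combination (1 - x) ^ 2 * (1 + (1 - x) + (1 - u) * (1 - x) ^ 2
      + (1 - 2 * u) * (1 - x) ^ 3) * hWD

lemma ex_2 (q : ℂ[X]) (hm : q.Monic) (hd : q.natDegree = 2) (h1 : q.eval 1 ≠ 0) (c : ℂ)
    (hc : c = q.coeff 0) :
    EX (fun x => (1 - x) ^ (2 * 2) * (c * (-1) ^ 2 / (x ^ 2 * q.eval x⁻¹ * q.eval x)))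
      (c / q.eval 1 ^ 2) (2 * c / q.eval 1 ^ 2) := by
  set s := q.eval 1 with hs
  set b := q.coeff 1 with hb
  have hev : ∀ x, q.eval x = c + b * x + x ^ 2 := by
    intro x
    have h2 : q.coeff 2 = 1 := by rw [← hd]; exact hm
    rw [Polynomial.eval_eq_sum_range, hd]
    simp [Finset.sum_range_succ, h2, hc, hb]
  refine ⟨fun j => if j = 4 then c / s ^ 2 else if j = 5 then 2 * c / s ^ 2 else 0,
    by simp, by simp,
    fun x => c / s ^ 2 * (s ^ 2 * (3 - 2 * (1 - x)) - (1 + 2 * (1 - x)) *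
      ((4 * c + b * (1 + c)) * x + c * (1 - x) ^ 2)) * (1 / (x ^ 2 * q.eval x⁻¹ * q.eval x)), ?_, ?_⟩
  · have h2 := an_R q 2 1 h1
    have h3 : AnalyticAt ℂ (fun x : ℂ => c / s ^ 2 * (s ^ 2 * (3 - 2 * (1 - x)) -
      (1 + 2 * (1 - x)) * ((4 * c + b * (1 + c)) * x + c * (1 - x) ^ 2))) 1 := by
      fun_prop
    exact h3.mul h2
  · filter_upwards [ne_ev q h1] with x hx
    obtain ⟨x0, x1, x2⟩ := hx
    have hD0 : x ^ 2 * q.eval x⁻¹ * q.eval x ≠ 0 :=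
      mul_ne_zero (mul_ne_zero (pow_ne_zero 2 x0) x1) x2
    have hD : x ^ 2 * q.eval x⁻¹ * q.eval x = s ^ 2 * x ^ 2 + (4 * c + b * (1 + c)) * (1 - x) ^ 2 * x
        + c * (1 - x) ^ 4 := by
      have hs' : s = c + b + 1 := by rw [hs, hev]; ring
      rw [hs', hev, hev]
      field_simp
      ring
    set D := x ^ 2 * q.eval x⁻¹ * q.eval x with hDD
    clear_value D
    clear hDD
    simp [Finset.sum_range_succ]
    rw [← sub_eq_zero]
    field_simp
    rw [hD]
    ring

def QT {n : ℕ} (A : Matrix (Fin n) (Fin n) ℂ) (q : ℂ[X]) : Prop :=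
  q.Monic ∧ q.degree = 2 ∧ q.eval 1 ≠ 0 ∧ A.charpoly = (X - 1) ^ (n - 2) * q

lemma QT.two_le {n : ℕ} {A : Matrix (Fin n) (Fin n) ℂ} {q : ℂ[X]} (h : QT A q) : 2 ≤ n := by
  obtain ⟨h1, h2, h3, h4⟩ := h
  have h5 := congrArg natDegree h4
  rw [Matrix.charpoly_natDegree_eq_dim, ← C_1, Monic.natDegree_mul ((monic_X_sub_C _).pow _) h1,
    natDegree_eq_of_degree_eq_some h2] at h5
  simp at h5
  omega

lemma mult_eq (p q : ℂ[X]) (a : ℕ) (h : p = (X - 1) ^ a * q) (hq : q.eval 1 ≠ 0) :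
    p.rootMultiplicity 1 = a := by
  have hq0 : q ≠ 0 := by rintro rfl; simp at hq
  rw [h, ← C_1, rootMultiplicity_mul (mul_ne_zero (pow_ne_zero _ (X_sub_C_ne_zero _)) hq0),
    rootMultiplicity_X_sub_C_pow, rootMultiplicity_eq_zero hq, add_zero]

lemma PR.not_QT {n : ℕ} (hn : 1 ≤ n) {A : Matrix (Fin n) (Fin n) ℂ} {l : ℂ} {q : ℂ[X]}
    (h : PR A l) (h' : QT A q) : False := by
  have h1 := mult_eq _ _ _ h.2 (by simpa using sub_ne_zero.2 h.1.symm)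
  have h2 := mult_eq _ _ _ h'.2.2.2 h'.2.2.1
  have := h'.two_le
  omega

lemma PR.ex {n : ℕ} (hn : 1 ≤ n) {A B : Matrix (Fin n) (Fin n) ℂ} (hAB : B * A = 1) {l : ℂ}
    (h : PR A l) :
    EX (fun x => (1 - x) ^ (2 * n) * ((1 - x • A).det * (1 - x • B).det)⁻¹)
      (uu A.det - uu A.det ^ 2) (uu A.det - 2 * uu A.det ^ 2) := by
  have := ex_1 l h.1
  rw [h.det_eq hn]
  apply term_zero hn A B hAB _ h.2
  rw [h.det_eq hn]
  exact this

lemma QT.ex {n : ℕ} {A B : Matrix (Fin n) (Fin n) ℂ} (hAB : B * A = 1) {q : ℂ[X]}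
    (h : QT A q) :
    EX (fun x => (1 - x) ^ (2 * n) * ((1 - x • A).det * (1 - x • B).det)⁻¹)
      (A.det / q.eval 1 ^ 2) (2 * A.det / q.eval 1 ^ 2) := by
  have hn := h.two_le
  have hd : A.det = q.coeff 0 := by
    rw [Matrix.det_eq_sign_charpoly_coeff, h.2.2.2, coeff_zero_eq_eval_zero, coeff_zero_eq_eval_zero]
    obtain ⟨n, rfl⟩ : ∃ n', n = n' + 2 := ⟨n - 2, by omega⟩
    simp [pow_succ]
    rw [← mul_assoc, ← mul_pow]; simp
  apply term_zero hn A B hAB _ h.2.2.2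
  exact ex_2 q h.1 (natDegree_eq_of_degree_eq_some h.2.1) h.2.2.1 _ hd

lemma other_ex {n : ℕ} {A B : Matrix (Fin n) (Fin n) ℂ} (hAB : B * A = 1)
    (h1 : ¬ ∃ l, PR A l) (h2 : ¬ ∃ q, QT A q) :
    EX (fun x => (1 - x) ^ (2 * n) * ((1 - x • A).det * (1 - x • B).det)⁻¹) 0 0 := by
  obtain ⟨q, hq, hnd⟩ := exists_eq_pow_rootMultiplicity_mul_and_not_dvd A.charpoly
    A.charpoly_monic.ne_zero 1
  set a := A.charpoly.rootMultiplicity 1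
  have hq1 : q.eval 1 ≠ 0 := by rwa [dvd_iff_isRoot] at hnd
  have hqm : q.Monic := by
    have h := A.charpoly_monic
    rw [hq] at h
    exact ((monic_X_sub_C (1 : ℂ)).pow a).of_mul_monic_left h
  have hdeg : n = a + q.natDegree := by
    have h5 := congrArg natDegree hq
    rw [Matrix.charpoly_natDegree_eq_dim, Monic.natDegree_mul ((monic_X_sub_C _).pow _) hqm,
      natDegree_pow, natDegree_X_sub_C] at h5
    simpa using h5
  have hk : q.natDegree ≤ n := by omega
  have hc : A.charpoly = (X - 1) ^ (n - q.natDegree) * q := by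
    rw [show n - q.natDegree = a by omega, hq, C_1]
  rcases Nat.lt_or_ge q.natDegree 3 with hlt | hge
  · obtain h | h | h : q.natDegree = 0 ∨ q.natDegree = 1 ∨ q.natDegree = 2 := by omega
    · have hq' : q = 1 := hqm.natDegree_eq_zero.1 h
      subst hq'
      apply term_zero (k := 0) (by omega) A B hAB 1 (by simpa using hc)
      have hd : A.det = 1 := by
        rw [Matrix.det_eq_sign_charpoly_coeff, hc, coeff_zero_eq_eval_zero]
        simp
        rw [← mul_pow]; simp
      rw [hd]
      simpa using ex_0
    · exfalso
      apply h1
      have hq' := hqm.eq_X_add_C h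
      refine ⟨- q.coeff 0, ?_, ?_⟩
      · intro h3
        apply hq1
        rw [hq']
        simp [← h3]
      · rw [h] at hc
        rw [hc, C_neg, sub_neg_eq_add, ← hq']
    · exact absurd ⟨q, hqm, by rw [degree_eq_natDegree hqm.ne_zero, h]; rfl, hq1, h ▸ hc⟩ h2
  · exact term_zero hk A B hAB q hc _ _ (ex_ge3 q _ hge _ hq1)

/-- for a finite subgroup `Γ ≤ U_n(ℂ)` with a set of primitive
pseudoreflections `g_1, …, g_r`, with `Q` the set of elements of `Γ` whose eigenvalue `1`
has multiplicity exactly `n-2` (charpoly `= (X-1)^{n-2} q_g(X)`, `q_g` monic quadratic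
with `q_g(1) ≠ 0`), and `G` an analytic extension of `(1-x)^{2n} M_Γ(x)` near `x = 1`,
the Laurent coefficients satisfy
`γ₄ = G⁗(1)/24 = (1/|Γ|)(Σ_i (-ord(g_i)⁴ + 50 ord(g_i)² - 49)/720 + Σ_{g∈Q} det g/q_g(1)²)`
and
`γ₅ = -G⁽⁵⁾(1)/120 = (1/|Γ|)(Σ_i (-2 ord(g_i)⁴ + 40 ord(g_i)² - 38)/720 + Σ_{g∈Q} 2 det g/q_g(1)²)`. -/
theorem molien_series_real_invariants_gamma4_gamma5 (n : ℕ) (hn : 1 ≤ n)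
    (Γ : Subgroup (Matrix.unitaryGroup (Fin n) ℂ)) [Fintype Γ]
    (r : ℕ) (g : Fin r → Γ)
    (hpr : ∀ i : Fin r, ∃ lam : ℂ, lam ≠ 1 ∧
      Matrix.charpoly (((g i : Matrix.unitaryGroup (Fin n) ℂ) :
          Matrix (Fin n) (Fin n) ℂ))
        = (X - 1) ^ (n - 1) * (X - C lam))
    (hcover : ∀ h : Γ,
      (∃ lam : ℂ, lam ≠ 1 ∧
        Matrix.charpoly (((h : Matrix.unitaryGroup (Fin n) ℂ) :
            Matrix (Fin n) (Fin n) ℂ))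
          = (X - 1) ^ (n - 1) * (X - C lam)) →
      ∃ (i : Fin r) (k : ℤ), h = g i ^ k)
    (hprim : ∀ (i j : Fin r) (k l : ℤ), g i ^ k = g j ^ l → g i ^ k ≠ 1 →
      i = j ∧ k ≡ l [ZMOD (orderOf (g i))])
    (Q : Finset Γ) (q : Γ → Polynomial ℂ)
    (hQ : ∀ h : Γ, h ∈ Q ↔ ∃ q' : Polynomial ℂ, q'.Monic ∧ q'.degree = 2 ∧
      q'.eval 1 ≠ 0 ∧
      Matrix.charpoly (((h : Matrix.unitaryGroup (Fin n) ℂ) :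
          Matrix (Fin n) (Fin n) ℂ))
        = (X - 1) ^ (n - 2) * q')
    (hq : ∀ h ∈ Q, (q h).Monic ∧ (q h).degree = 2 ∧ (q h).eval 1 ≠ 0 ∧
      Matrix.charpoly (((h : Matrix.unitaryGroup (Fin n) ℂ) :
          Matrix (Fin n) (Fin n) ℂ))
        = (X - 1) ^ (n - 2) * q h)
    (G : ℂ → ℂ) (N : Set ℂ) (hN : N ∈ 𝓝 (1 : ℂ)) (hG : AnalyticOnNhd ℂ G N)
    (hGeq : ∀ x ∈ N, ‖x‖ < 1 →
      G x = (1 - x) ^ (2 * n) *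
        ((Fintype.card Γ : ℂ)⁻¹ * ∑ h : Γ,
          (Matrix.det (1 - x • ((h : Matrix.unitaryGroup (Fin n) ℂ) :
              Matrix (Fin n) (Fin n) ℂ)) *
            Matrix.det (1 - x • (((h⁻¹ : Γ) : Matrix.unitaryGroup (Fin n) ℂ) :
              Matrix (Fin n) (Fin n) ℂ)))⁻¹)) :
    (iteratedDeriv 4 G 1 / 24 =
      (Fintype.card Γ : ℂ)⁻¹ *
        ((∑ i : Fin r, (-(orderOf (g i) : ℂ) ^ 4 + 50 * (orderOf (g i) : ℂ) ^ 2 - 49) / 720)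
          + ∑ h ∈ Q,
              Matrix.det (((h : Matrix.unitaryGroup (Fin n) ℂ) :
                Matrix (Fin n) (Fin n) ℂ)) / ((q h).eval 1) ^ 2))
    ∧
    (-(iteratedDeriv 5 G 1) / 120 =
      (Fintype.card Γ : ℂ)⁻¹ *
        ((∑ i : Fin r, (-2 * (orderOf (g i) : ℂ) ^ 4 + 40 * (orderOf (g i) : ℂ) ^ 2 - 38) / 720)
          + ∑ h ∈ Q,
              2 * Matrix.det (((h : Matrix.unitaryGroup (Fin n) ℂ) :
                Matrix (Fin n) (Fin n) ℂ)) / ((q h).eval 1) ^ 2)) := by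
  classical
  let cm : Γ → Matrix (Fin n) (Fin n) ℂ := fun h =>
    ((h : Matrix.unitaryGroup (Fin n) ℂ) : Matrix (Fin n) (Fin n) ℂ)
  have cm_one : cm 1 = 1 := rfl
  have cm_mul : ∀ a b, cm (a * b) = cm a * cm b := fun a b => rfl
  have cm_inj : Function.Injective cm := fun a b hab => Subtype.ext (Subtype.ext hab)
  have cm_pow : ∀ (a : Γ) (k : ℕ), cm (a ^ k) = cm a ^ k := by
    intro a k
    induction k with
    | zero => simp [cm_one]
    | succ k ih => rw [pow_succ, cm_mul, ih, pow_succ]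
  have cm_ord : ∀ a : Γ, cm a ^ orderOf a = 1 := by
    intro a; rw [← cm_pow, pow_orderOf_eq_one, cm_one]
  have cm_inv : ∀ a : Γ, cm a⁻¹ * cm a = 1 := by
    intro a; rw [← cm_mul, inv_mul_cancel, cm_one]
  -- sum over pseudoreflections
  have hPRsum : ∀ φ : ℂ → ℂ, ∑ h : Γ, (if ∃ l, PR (cm h) l then φ (cm h).det else 0)
      = ∑ i : Fin r, ∑ k ∈ Ico 1 (orderOf (g i)), φ ((cm (g i)).det ^ k) := by
    intro φ
    rw [← Finset.sum_filter, Finset.sum_sigma']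
    symm
    have hpow : ∀ (i : Fin r) (k : ℕ), g i ^ k ≠ 1 → PR (cm (g i ^ k)) ((cm (g i)).det ^ k) := by
      intro i k hk
      obtain ⟨l, hl⟩ := hpr i
      have hl' : PR (cm (g i)) l := hl
      rw [hl'.det_eq hn, cm_pow]
      refine hl'.pow hn (orderOf_pos (g i)) (cm_ord _) k ?_
      rw [Ne, ← hl'.pow_eq_one_iff (orderOf_pos (g i)) (cm_ord _), ← cm_pow]
      intro h
      exact hk (cm_inj h)
    have hne : ∀ (i : Fin r) (k : ℕ), k ∈ Ico 1 (orderOf (g i)) → g i ^ k ≠ 1 := by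
      intro i k hk
      rw [Finset.mem_Ico] at hk
      exact pow_ne_one_of_lt_orderOf (by omega) hk.2
    refine Finset.sum_bij (fun p _ => g p.1 ^ p.2) ?_ ?_ ?_ ?_
    · rintro ⟨i, k⟩ hp
      simp only [Finset.mem_sigma, Finset.mem_univ, true_and] at hp
      simp only [Finset.mem_filter, Finset.mem_univ, true_and]
      exact ⟨_, hpow i k (hne i k hp)⟩
    · rintro ⟨i, k⟩ hp ⟨j, l⟩ hp' heq
      simp only [Finset.mem_sigma, Finset.mem_univ, true_and] at hp hp'
      have := hprim i j k l (by simpa using heq) (by simpa using hne i k hp)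
      obtain ⟨rfl, h2⟩ := this
      rw [Finset.mem_Ico] at hp hp'
      have h3 : k ≡ l [MOD orderOf (g i)] := (Int.natCast_modEq_iff).1 h2
      have h4 : k = l := Nat.ModEq.eq_of_lt_of_lt h3 hp.2 hp'.2
      rw [h4]
    · intro h hh
      simp only [Finset.mem_filter, Finset.mem_univ, true_and] at hh
      obtain ⟨i, k, hk⟩ := hcover h hh
      obtain ⟨l, hl⟩ := hh
      have hpos : (0 : ℤ) < orderOf (g i) := by exact_mod_cast orderOf_pos (g i)
      obtain ⟨k', hk'⟩ := Int.eq_ofNat_of_zero_le (Int.emod_nonneg k hpos.ne')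
      have e : h = g i ^ k' := by
        rw [hk, ← zpow_natCast, ← zpow_mod_orderOf, hk']
      have hlt : k' < orderOf (g i) := by
        have := Int.emod_lt_of_pos k hpos
        rw [hk'] at this; exact_mod_cast this
      refine ⟨⟨i, k'⟩, ?_, e.symm⟩
      simp only [Finset.mem_sigma, Finset.mem_univ, true_and, Finset.mem_Ico]
      refine ⟨?_, hlt⟩
      by_contra h0
      have h00 : k' = 0 := by omega
      rw [h00, pow_zero] at e
      apply hl.ne_one
      rw [e, cm_one]
    · rintro ⟨i, k⟩ hp
      simp only [Finset.mem_sigma, Finset.mem_univ, true_and] at hp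
      rw [(hpow i k (hne i k hp)).det_eq hn]
  have hprimroot : ∀ i, IsPrimitiveRoot (cm (g i)).det (orderOf (g i)) := by
    intro i
    obtain ⟨l, hl⟩ := hpr i
    have hl' : PR (cm (g i)) l := hl
    rw [hl'.det_eq hn]
    have hiff := hl'.pow_eq_one_iff (orderOf_pos (g i)) (cm_ord _)
    refine ⟨(hiff _).1 (cm_ord _), fun k hk => ?_⟩
    apply orderOf_dvd_of_pow_eq_one
    apply cm_inj
    rw [cm_pow, cm_one]
    exact (hiff k).2 hk
  have hterm : ∀ h : Γ, EX (fun x => (1 - x) ^ (2 * n) *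
      ((1 - x • cm h).det * (1 - x • cm h⁻¹).det)⁻¹)
      ((if ∃ l, PR (cm h) l then (fun z => uu z - uu z ^ 2) (cm h).det else 0)
        + (if h ∈ Q then (cm h).det / (q h).eval 1 ^ 2 else 0))
      ((if ∃ l, PR (cm h) l then (fun z => uu z - 2 * uu z ^ 2) (cm h).det else 0)
        + (if h ∈ Q then 2 * (cm h).det / (q h).eval 1 ^ 2 else 0)) := by
    intro h
    by_cases hQh : h ∈ Q
    · have hqt : QT (cm h) (q h) := hq h hQh
      have hnp : ¬ ∃ l, PR (cm h) l := fun ⟨l, hl⟩ => hl.not_QT hn hqt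
      rw [if_pos hQh, if_neg hnp, if_pos hQh, if_neg hnp, zero_add, zero_add]
      exact hqt.ex (cm_inv h)
    · rw [if_neg hQh, if_neg hQh, add_zero, add_zero]
      by_cases hp : ∃ l, PR (cm h) l
      · rw [if_pos hp, if_pos hp]
        obtain ⟨l, hl⟩ := hp
        exact hl.ex hn (cm_inv h)
      · rw [if_neg hp, if_neg hp]
        exact other_ex (cm_inv h) hp (fun ⟨q', hq'⟩ => hQh ((hQ h).2 ⟨q', hq'⟩))
  have htot := (EX.sum Finset.univ _ _ _ (fun h _ => hterm h)).const_mul (Fintype.card Γ : ℂ)⁻¹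
  have hfreq := freq_disc N hN _ hGeq
  have hres := htot.derivs (hG 1 (mem_of_mem_nhds hN)) (hfreq.mono fun x hx => by
    rw [hx, ← Finset.mul_sum]
    ring)
  rw [Finset.sum_add_distrib, Finset.sum_add_distrib, hPRsum (fun z => uu z - uu z ^ 2),
    hPRsum (fun z => uu z - 2 * uu z ^ 2),
    ← Finset.sum_filter, ← Finset.sum_filter, Finset.filter_mem_eq_inter, Finset.univ_inter] at hres
  have s4 : ∀ i, ∑ k ∈ Ico 1 (orderOf (g i)), (fun z => uu z - uu z ^ 2) ((cm (g i)).det ^ k)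
      = (-(orderOf (g i) : ℂ) ^ 4 + 50 * (orderOf (g i) : ℂ) ^ 2 - 49) / 720 := by
    intro i
    rw [Finset.sum_sub_distrib, uu_sum _ (orderOf_pos _) _ (hprimroot i),
      uu_sum_sq _ (orderOf_pos _) _ (hprimroot i)]
    ring
  have s5 : ∀ i, ∑ k ∈ Ico 1 (orderOf (g i)), (fun z => uu z - 2 * uu z ^ 2) ((cm (g i)).det ^ k)
      = (-2 * (orderOf (g i) : ℂ) ^ 4 + 40 * (orderOf (g i) : ℂ) ^ 2 - 38) / 720 := by
    intro i
    rw [Finset.sum_sub_distrib, ← Finset.mul_sum, uu_sum _ (orderOf_pos _) _ (hprimroot i),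
      uu_sum_sq _ (orderOf_pos _) _ (hprimroot i)]
    ring
  simp only [s4, s5] at hres
  obtain ⟨r4, r5⟩ := hres
  constructor
  · rw [r4, mul_div_cancel_left₀ _ (by norm_num : (24 : ℂ) ≠ 0)]
  · rw [r5]
    rw [neg_mul, neg_neg, mul_div_cancel_left₀ _ (by norm_num : (120 : ℂ) ≠ 0)]
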